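/- (Density Hales–Jewett, Furstenberg–Katznelson) Let Σ = {α_1, …, α_k} be a finite alphabet with k ∈ ℕ letters, let W(Σ) = ⋃_{n∈ℕ} W_n(Σ) be the set of all finite words over Σ, where W_n(Σ) is the set of words of length n. If A ⊆ W(Σ) satisfies limsup_n |A ∩ W_n(Σ)| / k^n > 0, then A contains a combinatorial line: there exists a variable word w(υ) ∈ W(Σ ∪ {υ}) (υ ∉ Σ, with at least one occurrence of υ) such that {w(α) : α ∈ Σ} ⊆ A, where w(α) is obtained from w(υ) by substituting the letter α for every occurrence of υ. -/

import Mathlib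

namespace DHJ
open Classical

/-- Sum over a finite type. -/
noncomputable def S {X : Type*} [Finite X] (f : X → ℝ) : ℝ :=
  letI := Fintype.ofFinite X; ∑ x, f x

/-- Size of a finite type. -/
noncomputable def N (X : Type*) [Finite X] : ℝ := S (fun _ : X => 1)

/-- Number of elements satisfying `p`. -/
noncomputable def cnt {X : Type*} [Finite X] (p : X → Prop) : ℝ :=
  S (fun x => if p x then 1 else 0)

section basics
variable {X Y : Type*} [Finite X] [Finite Y]

lemma S_eq {X : Type*} [Fintype X] (f : X → ℝ) : S f = ∑ x, f x := by
  unfold S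
  congr!

lemma S_le {f g : X → ℝ} (h : ∀ x, f x ≤ g x) : S f ≤ S g :=
  Finset.sum_le_sum fun x _ => h x

lemma S_nonneg {f : X → ℝ} (h : ∀ x, 0 ≤ f x) : 0 ≤ S f :=
  Finset.sum_nonneg fun x _ => h x

lemma S_add (f g : X → ℝ) : S (fun x => f x + g x) = S f + S g :=
  Finset.sum_add_distrib

lemma S_sub (f g : X → ℝ) : S (fun x => f x - g x) = S f - S g :=
  Finset.sum_sub_distrib _ _

lemma S_mul (c : ℝ) (f : X → ℝ) : S (fun x => c * f x) = c * S f :=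
  (Finset.mul_sum _ _ _).symm

lemma S_mul' (c : ℝ) (f : X → ℝ) : S (fun x => f x * c) = S f * c :=
  (Finset.sum_mul _ _ _).symm

lemma S_const (c : ℝ) : S (fun _ : X => c) = c * N X := by
  unfold N; rw [← S_mul]; simp

lemma S_comm (f : X → Y → ℝ) : S (fun x => S (fun y => f x y)) = S (fun y => S (fun x => f x y)) :=
  Finset.sum_comm

lemma S_equiv (e : X ≃ Y) (f : Y → ℝ) : S (fun x => f (e x)) = S f := by
  let _ := Fintype.ofFinite X; let _ := Fintype.ofFinite Y
  rw [S_eq, S_eq]; exact Equiv.sum_comp e f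

lemma S_prod (f : X × Y → ℝ) : S f = S (fun x => S (fun y => f (x, y))) := by
  let _ := Fintype.ofFinite X; let _ := Fintype.ofFinite Y
  simp only [S_eq]; exact Fintype.sum_prod_type f

lemma S_sum {ι κ α : Type*} [Finite ι] [Finite κ] [Finite α] (f : (ι ⊕ κ → α) → ℝ) :
    S f = S (fun x : ι → α => S (fun y : κ → α => f (Sum.elim x y))) := by
  rw [← S_equiv (Equiv.sumArrowEquivProdArrow ι κ α).symm, S_prod]; rfl

lemma le_S {f : X → ℝ} (h : ∀ x, 0 ≤ f x) (x : X) : f x ≤ S f :=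
  Finset.single_le_sum (f := f) (fun i _ => h i) (by
    let _ := Fintype.ofFinite X; exact Finset.mem_univ x)

lemma exists_of_S_le [Nonempty X] {f g : X → ℝ} (h : S f ≤ S g) : ∃ x, f x ≤ g x := by
  let _ := Fintype.ofFinite X
  rw [S_eq, S_eq] at h
  obtain ⟨x, -, hx⟩ := Finset.exists_le_of_sum_le Finset.univ_nonempty h
  exact ⟨x, hx⟩

lemma N_nonneg : 0 ≤ N X := S_nonneg fun _ => zero_le_one

lemma N_eq : N X = Nat.card X := by
  let _ := Fintype.ofFinite X
  unfold N; rw [S_eq]; simp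

lemma N_ge_one [Nonempty X] : 1 ≤ N X := by
  rw [N_eq]; exact_mod_cast Nat.card_pos

lemma N_pos [Nonempty X] : 0 < N X := lt_of_lt_of_le one_pos N_ge_one

lemma N_prod : N (X × Y) = N X * N Y := by
  simp [N_eq]

lemma N_sum {ι κ α : Type*} [Finite ι] [Finite κ] [Finite α] :
    N (ι ⊕ κ → α) = N (ι → α) * N (κ → α) := by
  rw [← N_prod, N_eq, N_eq]
  exact_mod_cast Nat.card_congr (Equiv.sumArrowEquivProdArrow ι κ α)

lemma cnt_nonneg (p : X → Prop) : 0 ≤ cnt p := S_nonneg fun x => by split_ifs <;> simp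

lemma cnt_mono {p q : X → Prop} (h : ∀ x, p x → q x) : cnt p ≤ cnt q :=
  S_le fun x => by
    by_cases hp : p x
    · simp [hp, h x hp]
    · simp only [hp, if_false]; split_ifs <;> simp

lemma cnt_le_N (p : X → Prop) : cnt p ≤ N X := S_le fun x => by split_ifs <;> simp

lemma cnt_congr {p q : X → Prop} (h : ∀ x, p x ↔ q x) : cnt p = cnt q := by
  unfold cnt; congr; ext x; simp [h x]

lemma cnt_not (p : X → Prop) : cnt (fun x => ¬ p x) = N X - cnt p := by
  unfold cnt N; rw [← S_sub]; congr; ext x; by_cases h : p x <;> simp [h]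

lemma exists_of_cnt_pos {p : X → Prop} (h : 0 < cnt p) : ∃ x, p x := by
  by_contra hc
  push Not at hc
  have : cnt p = 0 := by unfold cnt; simp only [hc, if_false]; rw [S_const]; simp
  linarith

lemma cnt_pos {p : X → Prop} (x : X) (h : p x) : 1 ≤ cnt p := by
  have := le_S (f := fun x => if p x then (1 : ℝ) else 0) (fun x => by split_ifs <;> simp) x
  simpa [h, cnt] using this

lemma S_cnt_comm (p : X → Y → Prop) :
    S (fun x => cnt (fun y => p x y)) = S (fun y => cnt (fun x => p x y)) := S_comm _

lemma cnt_equiv (e : X ≃ Y) (p : Y → Prop) : cnt (fun x => p (e x)) = cnt p :=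
  S_equiv e (fun y => if p y then 1 else 0)

/-- Averaging plus pigeonhole. -/
lemma pigeon {X Ω K : Type*} [Finite X] [Finite Ω] [Finite K] [Nonempty K] [Nonempty X]
    (δ : ℝ) (hδ : 0 ≤ δ) (A : X → Ω → Prop) (P : K → Ω → Prop)
    (hA : δ * (N X * N Ω) ≤ S (fun x => cnt (fun ω => A x ω)))
    (h : ∀ ω, δ / 2 * N X ≤ cnt (fun x => A x ω) → ∃ κ, P κ ω) :
    ∃ κ, δ / (2 * N K) * N Ω ≤ cnt (fun ω => P κ ω) := by
  have hX := N_pos (X := X)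
  have hK := N_pos (X := K)
  have h1 : S (fun ω => cnt (fun x => A x ω)) ≤
      S (fun ω => δ / 2 * N X + N X * S (fun κ => if P κ ω then (1 : ℝ) else 0)) := by
    apply S_le
    intro ω
    have h0 : 0 ≤ S (fun κ => if P κ ω then (1 : ℝ) else 0) :=
      S_nonneg fun x => by split_ifs <;> simp
    by_cases hc : δ / 2 * N X ≤ cnt (fun x => A x ω)
    · obtain ⟨κ, hκ⟩ := h ω hc
      have h2 : 1 ≤ S (fun κ => if P κ ω then (1 : ℝ) else 0) := cnt_pos κ hκ
      have h3 := cnt_le_N (fun x => A x ω)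
      have : 0 ≤ δ / 2 * N X := by positivity
      nlinarith
    · nlinarith
  rw [S_add, S_const, S_mul] at h1
  rw [S_cnt_comm] at hA
  rw [S_comm] at h1
  apply exists_of_S_le
  rw [S_const]
  have e : δ / (2 * N K) * N Ω * N K = δ / 2 * N Ω := by field_simp
  rw [e]
  have h2 : N X * (δ / 2 * N Ω) ≤ N X * S (fun κ => S (fun ω => if P κ ω then (1 : ℝ) else 0)) := by
    linarith
  exact le_of_mul_le_mul_left h2 hX

end basics
end DHJ

namespace DHJ
open Classical

/-- Substitute `b` for the variable `none`. -/
def sub {ι β : Type*} (x : ι → Option β) (b : β) : ι → β := fun i => (x i).getD b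

/-- The word contains the variable. -/
def IsVar {ι β : Type*} (x : ι → Option β) : Prop := ∃ i, x i = none

/-- Density Hales–Jewett over the alphabet `β`. -/
def HasDHJ (β : Type) [Finite β] : Prop :=
  ∀ δ : ℝ, 0 < δ → ∃ (ι : Type) (_ : Finite ι), ∀ A : (ι → β) → Prop,
    δ * N (ι → β) ≤ cnt A → ∃ x : ι → Option β, IsVar x ∧ ∀ b, A (sub x b)

/-- Evaluation of a subspace. -/
def ev {ι α η : Type*} (V : ι → α ⊕ η) (u : η → α) : ι → α := fun i => Sum.elim id u (V i)

/-- All wildcards occur. -/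
def Proper {ι α η : Type*} (V : ι → α ⊕ η) : Prop := ∀ e, ∃ i, V i = Sum.inr e

lemma ev_injective {ι α η : Type*} {V : ι → α ⊕ η} (hV : Proper V) :
    Function.Injective (ev V) := by
  intro u u' h
  ext e
  obtain ⟨i, hi⟩ := hV e
  have := congrFun h i
  simpa [ev, hi] using this

lemma mdhj_fin {β : Type} [Finite β] [Nonempty β] (h : HasDHJ β) (m : ℕ) : ∀ δ : ℝ, 0 < δ →
    ∃ (ξ : Type) (_ : Finite ξ), ∀ A : (ξ → β) → Prop, δ * N (ξ → β) ≤ cnt A →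
      ∃ V : ξ → β ⊕ Fin m, Proper V ∧ ∀ u, A (ev V u) := by
  induction m with
  | zero =>
    intro δ hδ
    refine ⟨Empty, inferInstance, fun A hA => ⟨fun e => e.elim, fun e => e.elim0, fun u => ?_⟩⟩
    have : 0 < cnt A := lt_of_lt_of_le (mul_pos hδ N_pos) hA
    obtain ⟨x, hx⟩ := exists_of_cnt_pos this
    convert hx
  | succ m ih =>
    intro δ hδ
    obtain ⟨ι, _, hι⟩ := h (δ / 2) (by positivity)
    have hK : 0 < N (ι → Option β) := N_pos
    obtain ⟨ξ, _, hξ⟩ := ih (δ / (2 * N (ι → Option β))) (by positivity)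
    refine ⟨ι ⊕ ξ, inferInstance, fun A hA => ?_⟩
    obtain ⟨x, hx⟩ := pigeon (X := ι → β) (Ω := ξ → β) (K := ι → Option β) δ hδ.le
      (fun x y => A (Sum.elim x y)) (fun x y => IsVar x ∧ ∀ b, A (Sum.elim (sub x b) y))
      (by rw [← N_sum]; unfold cnt at hA; rw [S_sum] at hA; exact hA)
      (fun y hy => hι _ hy)
    obtain ⟨V, hV, hVA⟩ := hξ _ hx
    refine ⟨Sum.elim (fun i => (x i).elim (Sum.inr 0) Sum.inl)
      (fun j => Sum.map id Fin.succ (V j)), ?_, ?_⟩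
    · intro e
      refine Fin.cases ?_ (fun e => ?_) e
      · obtain ⟨i, hi⟩ := (hVA (fun _ => Classical.arbitrary β)).1
        exact ⟨Sum.inl i, by simp [hi]⟩
      · obtain ⟨j, hj⟩ := hV e
        exact ⟨Sum.inr j, by simp [hj]⟩
    · intro u
      convert (hVA (fun e => u e.succ)).2 (u 0) using 1
      ext i
      rcases i with i | j
      · simp only [ev, Sum.elim_inl, sub]
        cases x i <;> simp
      · simp only [ev, Sum.elim_inr]
        cases V j <;> simp

lemma mdhj_emb {β : Type} [Finite β] [Nonempty β] (h : HasDHJ β) (ζ : Type) [Finite ζ]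
    (δ : ℝ) (hδ : 0 < δ) :
    ∃ n : ℕ, ∀ (ι : Type) [Finite ι] (T : ι → Prop), n ≤ Nat.card {i // T i} →
      ∀ A : (ι → β) → Prop, δ * N (ι → β) ≤ cnt A →
      ∃ V : ι → β ⊕ ζ, Proper V ∧ (∀ i e, V i = Sum.inr e → T i) ∧ ∀ u, A (ev V u) := by
  obtain ⟨ξ, _, hξ⟩ := mdhj_fin h (Nat.card ζ) δ hδ
  refine ⟨Nat.card ξ, fun ι _ T hT A hA => ?_⟩
  obtain ⟨e0⟩ : Nonempty (ξ ↪ {i // T i}) := by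
    let _ := Fintype.ofFinite ξ; let _ := Fintype.ofFinite {i // T i}
    rw [Nat.card_eq_fintype_card, Nat.card_eq_fintype_card] at hT
    exact Function.Embedding.nonempty_of_card_le hT
  let e : ξ → ι := fun p => (e0 p).1
  have he : Function.Injective e := Subtype.val_injective.comp e0.injective
  have heT : ∀ p, T (e p) := fun p => (e0 p).2
  let F : (ι → β) × (ξ → β) → (ι → β) × (ξ → β) := fun p =>
    (Function.extend e p.2 p.1, p.1 ∘ e)
  have hF : Function.Involutive F := by
    rintro ⟨w, v⟩
    simp only [F, Prod.mk.injEq]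
    constructor
    · ext i
      by_cases hi : ∃ p, e p = i
      · obtain ⟨p, rfl⟩ := hi
        rw [he.extend_apply]; rfl
      · rw [Function.extend_apply' _ _ _ hi, Function.extend_apply' _ _ _ hi]
    · ext p
      simp [he.extend_apply]
  have h1 : S (fun w : ι → β => cnt (fun v : ξ → β => A (Function.extend e v w))) =
      N (ξ → β) * cnt A := by
    have := S_equiv hF.toPerm (fun p => if A p.1 then (1 : ℝ) else 0)
    rw [S_prod, S_prod] at this
    unfold cnt
    refine this.trans ?_
    rw [← S_mul]
    congr
    ext x
    exact (S_const (X := ξ → β) (if A x then (1 : ℝ) else 0)).trans (mul_comm _ _)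
  have h2 : S (fun _ : ι → β => δ * N (ξ → β)) ≤
      S (fun w : ι → β => cnt (fun v : ξ → β => A (Function.extend e v w))) := by
    rw [h1, S_const]
    have := N_nonneg (X := ξ → β)
    nlinarith
  obtain ⟨w, hw⟩ := exists_of_S_le h2
  obtain ⟨V, hV, hVA⟩ := hξ _ hw
  let g : Fin (Nat.card ζ) ≃ ζ := (Finite.equivFin ζ).symm
  refine ⟨Function.extend e (fun p => Sum.map id g (V p)) (fun i => Sum.inl (w i)), ?_, ?_, ?_⟩
  · intro z
    obtain ⟨p, hp⟩ := hV (g.symm z)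
    exact ⟨e p, by rw [he.extend_apply, hp]; simp⟩
  · intro i z hi
    by_cases hp : ∃ p, e p = i
    · obtain ⟨p, rfl⟩ := hp
      exact heT p
    · rw [Function.extend_apply' _ _ _ hp] at hi
      cases hi
  · intro u
    convert hVA (u ∘ g) using 1
    ext i
    by_cases hp : ∃ p, e p = i
    · obtain ⟨p, rfl⟩ := hp
      simp only [ev, he.extend_apply]
      cases V p <;> simp
    · simp only [ev, Function.extend_apply' _ _ _ hp, Sum.elim_inl, id]

end DHJ

namespace DHJ
open Classical

/-- Replace the extra letter `none` by `some b`. -/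
def fl {ι β : Type*} (b : β) (s : ι → Option β) : ι → Option β := fun i => some ((s i).getD b)

/-- Insensitivity with respect to swapping `none` and `some b`. -/
def Insens {ι β : Type*} (b : β) (D : (ι → Option β) → Prop) : Prop := ∀ s, D s ↔ D (fl b s)

lemma fl_fl {ι β : Type*} (b : β) (s : ι → Option β) : fl b (fl b s) = fl b s := rfl

lemma N_pi (M : ℕ) (α : Type) [Finite α] : N (Fin M → α) = N α ^ M := by
  simp [N_eq, Nat.card_pi]

lemma N_option (β : Type) [Finite β] : N (Option β) = 1 + N β := by
  simp [N_eq, Finite.card_option, add_comm]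

lemma few_bound {β : Type} [Finite β] (n M : ℕ) :
    cnt (fun x : Fin M → Option β => Nat.card {i // x i ≠ none} < n) ≤
      2 ^ n * (1 + N β / 2) ^ M := by
  let _ := Fintype.ofFinite β
  let w : Option β → ℝ := fun o => if o = none then 1 else 1 / 2
  have h1 : S (fun x : Fin M → Option β => ∏ i, w (x i)) = (1 + N β / 2) ^ M := by
    rw [S_eq]
    have := Finset.prod_univ_sum (fun _ : Fin M => (Finset.univ : Finset (Option β)))
      (fun _ o => w o)
    rw [Fintype.piFinset_univ] at this
    rw [← this]
    simp [w, Fintype.sum_option, N_eq, div_eq_mul_inv]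
  rw [← h1, ← S_mul]
  apply S_le
  intro x
  have hw : ∏ i, w (x i) = (1 / 2) ^ (Nat.card {i // x i ≠ none}) := by
    simp only [w]
    rw [Finset.prod_ite]
    simp [Fintype.card_subtype]
  rw [hw]
  split_ifs with hc
  · have : (1 / 2 : ℝ) ^ n ≤ (1 / 2) ^ (Nat.card {i // x i ≠ none}) :=
      pow_le_pow_of_le_one (by norm_num) (by norm_num) hc.le
    calc (1 : ℝ) = 2 ^ n * (1 / 2) ^ n := by rw [← mul_pow]; norm_num
      _ ≤ _ := by gcongr
  · positivity

lemma few_small {β : Type} [Finite β] [Nonempty β] (n : ℕ) (η : ℝ) (hη : 0 < η) :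
    ∃ M : ℕ, cnt (fun x : Fin M → Option β => Nat.card {i // x i ≠ none} < n) ≤
      η * N (Fin M → Option β) := by
  have hk : 0 < N β := N_pos
  have hq : (1 + N β / 2) / (1 + N β) < 1 := by rw [div_lt_one (by positivity)]; linarith
  obtain ⟨M, hM⟩ := exists_pow_lt_of_lt_one (show 0 < η / 2 ^ n by positivity) hq
  refine ⟨M, (few_bound n M).trans ?_⟩
  rw [N_pi, N_option]
  rw [div_pow, div_lt_div_iff₀ (by positivity) (by positivity)] at hM
  linarith

lemma insens_sub {β : Type} [Finite β] [Nonempty β] (h : HasDHJ β) (b : β) (ζ : Type) [Finite ζ]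
    (η : ℝ) (hη : 0 < η) :
    ∃ (ξ : Type) (_ : Finite ξ), ∀ D : (ξ → Option β) → Prop, Insens b D →
      η * N (ξ → Option β) ≤ cnt D →
      ∃ V : ξ → Option β ⊕ ζ, Proper V ∧ ∀ u, D (ev V u) := by
  obtain ⟨n, hn⟩ := mdhj_emb h ζ (η / 2) (by positivity)
  obtain ⟨M, hM⟩ := few_small (β := β) n (η / 4) (by positivity)
  refine ⟨Fin M, inferInstance, fun D hD hc => ?_⟩
  let z : (Fin M → Option β) → (Fin M → β) → (Fin M → Option β) :=
    fun x w i => (x i).map (fun _ => w i)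
  let F : (Fin M → Option β) × (Fin M → β) → (Fin M → Option β) × (Fin M → β) := fun p =>
    (z p.1 p.2, fun i => (p.1 i).getD (p.2 i))
  have hF : Function.Involutive F := by
    rintro ⟨x, w⟩
    simp only [F, z, Prod.mk.injEq]
    constructor <;> ext i <;> cases hx : x i <;> simp
  have h1 : S (fun x => cnt (fun w => D (z x w))) = N (Fin M → β) * cnt D := by
    have := S_equiv hF.toPerm (fun p => if D p.1 then (1 : ℝ) else 0)
    rw [S_prod, S_prod] at this
    unfold cnt
    refine this.trans ?_
    rw [← S_mul]
    congr
    ext x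
    exact (S_const (X := Fin M → β) (if D x then (1 : ℝ) else 0)).trans (mul_comm _ _)
  have hNβ : 0 < N (Fin M → β) := N_pos
  have hNo : 0 < N (Fin M → Option β) := N_pos
  obtain ⟨x, hx1, hx2⟩ : ∃ x : Fin M → Option β, n ≤ Nat.card {i // x i ≠ none} ∧
      η / 2 * N (Fin M → β) ≤ cnt (fun w => D (z x w)) := by
    by_contra hcon
    push Not at hcon
    have h2 : S (fun x => cnt (fun w => D (z x w))) ≤
        S (fun x : Fin M → Option β => η / 2 * N (Fin M → β) + N (Fin M → β) *
          (if Nat.card {i // x i ≠ none} < n then (1 : ℝ) else 0)) := by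
      apply S_le
      intro x
      have h3 := cnt_le_N (fun w => D (z x w))
      split_ifs with hs
      · have : 0 ≤ η / 2 * N (Fin M → β) := by positivity
        linarith
      · have := hcon x (not_lt.1 hs)
        linarith
    rw [h1, S_add, S_const, S_mul] at h2
    have h4 : S (fun x : Fin M → Option β =>
      (if Nat.card {i // x i ≠ none} < n then (1 : ℝ) else 0)) ≤ η / 4 * N (Fin M → Option β) := by
      unfold cnt at hM; convert hM
    have h5 : N (Fin M → β) * (η * N (Fin M → Option β)) ≤ N (Fin M → β) *
       (η / 2 * N (Fin M → Option β) + η / 4 * N (Fin M → Option β)) := by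
      have := mul_le_mul_of_nonneg_left hc hNβ.le
      have := mul_le_mul_of_nonneg_left h4 hNβ.le
      linarith
    have := le_of_mul_le_mul_left h5 hNβ
    have : 0 < η * N (Fin M → Option β) := by positivity
    linarith
  obtain ⟨V, hV, hVT, hVA⟩ := hn (Fin M) (fun i => x i ≠ none) hx1 _ hx2
  refine ⟨fun i => if x i = none then Sum.inl none else Sum.map some id (V i), ?_, ?_⟩
  · intro e
    obtain ⟨i, hi⟩ := hV e
    refine ⟨i, ?_⟩
    have := hVT i e hi
    simp [this, hi]
  · intro u
    have := hVA (sub u b)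
    rw [hD] at this ⊢
    convert this using 1
    ext1 i
    simp only [fl, ev, z]
    cases hx : x i
    · simp
    · cases hVi : V i <;> simp [sub]

end DHJ

namespace DHJ
open Classical

lemma S_range {U X : Type*} [Finite U] [Finite X] (g : U → X) (hg : Function.Injective g)
    (F : X → ℝ) : S (fun u => F (g u)) = S (fun x => if ∃ u, g u = x then F x else 0) := by
  let _ := Fintype.ofFinite U; let _ := Fintype.ofFinite X
  rw [S_eq, S_eq]
  trans ∑ x ∈ Finset.univ.filter (fun x => ∃ u, g u = x), F x
  · rw [← Finset.sum_image (s := Finset.univ) (g := g) (f := F) hg.injOn]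
    congr 1
    ext x
    simp
  · rw [Finset.sum_filter]; congr!

lemma cnt_sum {ι κ α : Type*} [Finite ι] [Finite κ] [Finite α] (p : (ι ⊕ κ → α) → Prop) :
    cnt p = S (fun x : ι → α => cnt (fun y : κ → α => p (Sum.elim x y))) := S_sum _

lemma fl_elim {ι κ β : Type*} (b : β) (x : ι → Option β) (y : κ → Option β) :
    fl b (Sum.elim x y) = Sum.elim (fl b x) (fl b y) := by
  ext1 i; cases i <;> rfl

lemma Insens.slice_right {ι κ β : Type*} {b : β} {D : (ι ⊕ κ → Option β) → Prop} (hD : Insens b D)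
    (x : ι → Option β) : Insens b (fun y => D (Sum.elim x y)) := by
  intro y
  dsimp only
  rw [hD, hD (Sum.elim x (fl b y)), fl_elim, fl_elim, fl_fl]

lemma Insens.slice_left {ι κ β : Type*} {b : β} {D : (ι ⊕ κ → Option β) → Prop} (hD : Insens b D)
    (y : κ → Option β) : Insens b (fun x => D (Sum.elim x y)) := by
  intro x
  dsimp only
  rw [hD, hD (Sum.elim (fl b x) y), fl_elim, fl_elim, fl_fl]

lemma S_ite_le_cnt {X : Type*} [Finite X] (f : X → ℝ) (hf : ∀ x, f x ≤ 1) (D : X → Prop) :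
    S (fun x => if D x then f x else 0) ≤ cnt D :=
  S_le fun x => by
    by_cases h : D x
    · simp [h, hf x]
    · simp [h]

lemma tile_rec {β : Type} [Finite β] [Nonempty β] (h : HasDHJ β) (b : β) (ζ₀ : Type) [Finite ζ₀]
    (η : ℝ) (hη : 0 < η) (hη1 : η ≤ 1) :
    ∃ q : ℝ, 0 ≤ q ∧ q < 1 ∧ ∀ t : ℕ, ∃ (ζ : Type) (_ : Finite ζ), ∀ f : (ζ → Option β) → ℝ,
      (∀ x, f x ≤ 1) →
      (∀ V : ζ → Option β ⊕ ζ₀, Proper V → S (fun u => f (ev V u)) ≤ 0) →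
      ∀ D, Insens b D →
        S (fun x => if D x then f x else 0) ≤ η * N (ζ → Option β) + q ^ t * cnt D := by
  obtain ⟨ξ, _, hξ⟩ := insens_sub h b ζ₀ (η / 2) (by positivity)
  have : Nonempty (ξ → Option β ⊕ ζ₀) := ⟨fun _ => Sum.inl none⟩
  have hK : 1 ≤ N (ξ → Option β ⊕ ζ₀) := N_ge_one
  have hX : 1 ≤ N (ξ → Option β) := N_ge_one
  set c : ℝ := η / (2 * N (ξ → Option β ⊕ ζ₀)) with hc
  have hc0 : 0 < c := by positivity
  have hc1 : c ≤ 1 := by rw [hc, div_le_one (by positivity)]; linarith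
  have hcX : c / N (ξ → Option β) ≤ 1 := by rw [div_le_one (by positivity)]; linarith
  have hcX0 : 0 < c / N (ξ → Option β) := by positivity
  refine ⟨1 - c / N (ξ → Option β), by linarith, by linarith, fun t => ?_⟩
  set q := 1 - c / N (ξ → Option β) with hq
  have hq0 : 0 ≤ q := by linarith
  induction t with
  | zero =>
    refine ⟨Empty, inferInstance, fun f hf _ D _ => ?_⟩
    have := S_ite_le_cnt f hf D
    have : 0 ≤ η * N (Empty → Option β) := mul_nonneg hη.le N_nonneg
    simp only [pow_zero, one_mul]
    linarith
  | succ t ih =>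
    obtain ⟨ζ, _, hζ⟩ := ih
    refine ⟨ξ ⊕ ζ, inferInstance, fun f hf hfV D hD => ?_⟩
    by_cases hDd : η * N (ξ ⊕ ζ → Option β) ≤ cnt D
    swap
    · have := S_ite_le_cnt f hf D
      have : 0 ≤ q ^ (t + 1) * cnt D := mul_nonneg (by positivity) (cnt_nonneg _)
      linarith
    obtain ⟨V, hVY⟩ := pigeon (X := ξ → Option β) (Ω := ζ → Option β) (K := ξ → Option β ⊕ ζ₀) η hη.le
      (fun x y => D (Sum.elim x y)) (fun V y => Proper V ∧ ∀ u, D (Sum.elim (ev V u) y))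
      (by rw [← N_sum, ← cnt_sum]; exact hDd)
      (fun y hy => hξ _ (hD.slice_left y) hy)
    rw [← hc] at hVY
    have hNζ : 0 < N (ζ → Option β) := N_pos
    obtain ⟨-, hV, -⟩ := exists_of_cnt_pos (lt_of_lt_of_le (by positivity) hVY)
    set Y : (ζ → Option β) → Prop := fun y => ∀ u, D (Sum.elim (ev V u) y) with hYdef
    replace hVY : c * N (ζ → Option β) ≤ cnt Y := by
      refine hVY.trans (cnt_mono fun y hy => hy.2)
    have hYi : Insens b Y := fun y => forall_congr' fun u => hD.slice_right _ y
    obtain ⟨R, hR⟩ : ∃ R : (ξ → Option β) → Prop, R = fun x => ∃ u, ev V u = x := ⟨_, rfl⟩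
    have hRY : ∀ x y, R x → Y y → D (Sum.elim x y) := by
      subst hR
      rintro _ y ⟨u, rfl⟩ hy
      exact hy u
    obtain ⟨D', hDd'⟩ : ∃ D' : (ξ → Option β) → (ζ → Option β) → Prop, D' = fun x y =>
      D (Sum.elim x y) ∧ ¬ (R x ∧ Y y) := ⟨_, rfl⟩
    have hD' : ∀ x, Insens b (D' x) := fun x y => by
      subst hDd'
      exact and_congr (hD.slice_right x y) (not_congr (and_congr Iff.rfl (hYi y)))
    -- the part covered by tiles
    have hcov : S (fun x => S (fun y => if R x ∧ Y y then f (Sum.elim x y) else 0)) ≤ 0 := by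
      rw [S_comm]
      have h0 : (0 : ℝ) = S (fun _ : ζ → Option β => (0 : ℝ)) := by rw [S_const]; simp
      refine le_trans (S_le (g := fun _ => 0) ?_) h0.symm.le
      intro y
      by_cases hy : Y y
      · simp only [hy, and_true]
        subst hR
        rw [← S_range (ev V) (ev_injective hV) (fun x => f (Sum.elim x y))]
        have := hfV (Sum.elim V (fun j => Sum.inl (y j))) (fun e => by
          obtain ⟨i, hi⟩ := hV e
          exact ⟨Sum.inl i, hi⟩)
        convert this using 4 with u
        ext1 i
        cases i <;> rfl
      · simp only [hy, and_false, if_false]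
        rw [S_const]; simp
    -- the remaining part
    have hrem : ∀ x, S (fun y => if D' x y then f (Sum.elim x y) else 0) ≤
        η * N (ζ → Option β) + q ^ t * cnt (D' x) := by
      intro x
      refine hζ (fun y => f (Sum.elim x y)) (fun y => hf _) (fun W hW => ?_) _ (hD' x)
      have := hfV (Sum.elim (fun i => Sum.inl (x i)) W) (fun e => by
          obtain ⟨i, hi⟩ := hW e
          exact ⟨Sum.inr i, hi⟩)
      convert this using 4 with u
      ext1 i
      cases i <;> rfl
    have hsplit : S (fun x => if D x then f x else 0) =
        S (fun x => S (fun y => if D' x y then f (Sum.elim x y) else 0)) +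
        S (fun x => S (fun y => if R x ∧ Y y then f (Sum.elim x y) else 0)) := by
      rw [S_sum, ← S_add]
      congr 1; ext x
      rw [← S_add]
      congr 1; ext y
      by_cases h1 : R x ∧ Y y
      · have h2 : ¬ D' x y := by rw [hDd']; tauto
        simp [h2, h1, hRY x y h1.1 h1.2]
      · have h2 : D' x y ↔ D (Sum.elim x y) := by rw [hDd']; tauto
        simp only [h2, h1, if_false, add_zero]
    have hcnt : S (fun x => cnt (D' x)) + S (fun x => cnt (fun y => R x ∧ Y y)) = cnt D := by
      rw [cnt_sum, ← S_add]
      congr 1; ext x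
      unfold cnt
      rw [← S_add]
      congr 1; ext y
      by_cases h1 : R x ∧ Y y
      · have h2 : ¬ D' x y := by rw [hDd']; tauto
        simp [h2, h1, hRY x y h1.1 h1.2]
      · have h2 : D' x y ↔ D (Sum.elim x y) := by rw [hDd']; tauto
        simp only [h2, h1, if_false, add_zero]
    have hcY : cnt Y ≤ S (fun x => cnt (fun y => R x ∧ Y y)) := by
      have := le_S (f := fun x => cnt (fun y => R x ∧ Y y)) (fun x => cnt_nonneg _)
        (ev V (fun _ => none))
      refine le_trans (cnt_mono fun y hy => ?_) this
      exact ⟨by rw [hR]; exact ⟨_, rfl⟩, hy⟩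
    have hfin := S_le hrem
    rw [S_add, S_const, S_mul] at hfin
    have hDle := cnt_le_N D
    rw [N_sum] at hDle ⊢
    have hkey : S (fun x => cnt (D' x)) ≤ q * cnt D := by
      have : c / N (ξ → Option β) * cnt D ≤ c * N (ζ → Option β) := by
        calc _ ≤ c / N (ξ → Option β) * (N (ξ → Option β) * N (ζ → Option β)) := by gcongr
          _ = _ := by field_simp
      rw [hq]; linarith
    have := mul_le_mul_of_nonneg_left hkey (show 0 ≤ q ^ t by positivity)
    rw [hsplit, pow_succ]
    linarith

lemma tile {β : Type} [Finite β] [Nonempty β] (h : HasDHJ β) (b : β) (ζ₀ : Type) [Finite ζ₀]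
    (η : ℝ) (hη : 0 < η) :
    ∃ (ζ : Type) (_ : Finite ζ), ∀ f : (ζ → Option β) → ℝ, (∀ x, f x ≤ 1) →
      (∀ V : ζ → Option β ⊕ ζ₀, Proper V → S (fun u => f (ev V u)) ≤ 0) →
      ∀ D, Insens b D → S (fun x => if D x then f x else 0) ≤ η * N (ζ → Option β) := by
  have hm : 0 < min (η / 2) 1 := by positivity
  obtain ⟨q, hq0, hq1, ht⟩ := tile_rec h b ζ₀ (min (η / 2) 1) hm (min_le_right _ _)
  obtain ⟨t, hqt⟩ := exists_pow_lt_of_lt_one (show 0 < η / 2 by positivity) hq1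
  obtain ⟨ζ, _, hζ⟩ := ht t
  refine ⟨ζ, inferInstance, fun f hf hfV D hD => (hζ f hf hfV D hD).trans ?_⟩
  have h1 : min (η / 2) 1 * N (ζ → Option β) ≤ η / 2 * N (ζ → Option β) :=
    mul_le_mul_of_nonneg_right (min_le_left _ _) N_nonneg
  have h2 : q ^ t * cnt D ≤ η / 2 * N (ζ → Option β) :=
    mul_le_mul hqt.le (cnt_le_N D) (cnt_nonneg _) (by positivity)
  linarith

/-- Composition of subspaces. -/
def comp {ι α η ζ : Type*} (V : ι → α ⊕ η) (W : η → α ⊕ ζ) : ι → α ⊕ ζ :=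
  fun i => Sum.elim Sum.inl W (V i)

lemma ev_comp {ι α η ζ : Type*} (V : ι → α ⊕ η) (W : η → α ⊕ ζ) (u : ζ → α) :
    ev (comp V W) u = ev V (ev W u) := by
  ext i
  simp only [ev, comp]
  cases V i <;> rfl

lemma Proper.comp {ι α η ζ : Type*} {V : ι → α ⊕ η} {W : η → α ⊕ ζ} (hV : Proper V)
    (hW : Proper W) : Proper (comp V W) := by
  intro e
  obtain ⟨j, hj⟩ := hW e
  obtain ⟨i, hi⟩ := hV j
  exact ⟨i, by simp [DHJ.comp, hi, hj]⟩

lemma Insens.pull {ι β η : Type*} {b : β} {D : (ι → Option β) → Prop} (hD : Insens b D)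
    (V : ι → Option β ⊕ η) : Insens b (fun u => D (ev V u)) := by
  intro u
  dsimp only
  rw [hD, hD (ev V (fl b u))]
  apply iff_of_eq
  congr 1
  ext1 i
  simp only [fl, ev]
  cases V i <;> rfl

lemma multi_tile {β : Type} [Finite β] [Nonempty β] (h : HasDHJ β) (B : Finset β) :
    ∀ (ζ₀ : Type) [Finite ζ₀] (η : ℝ), 0 < η →
    ∃ (ζ : Type) (_ : Finite ζ), ∀ f : (ζ → Option β) → ℝ, (∀ x, f x ≤ 1) →
      (∀ V : ζ → Option β ⊕ ζ₀, Proper V → S (fun u => f (ev V u)) ≤ 0) →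
      ∀ D : β → (ζ → Option β) → Prop, (∀ b, Insens b (D b)) →
        S (fun x => if ∀ b ∈ B, D b x then f x else 0) ≤ η * N (ζ → Option β) := by
  induction B using Finset.induction_on with
  | empty =>
    intro ζ₀ _ η hη
    refine ⟨ζ₀, inferInstance, fun f hf hfV D hD => ?_⟩
    have := hfV (fun i => Sum.inr i) (fun e => ⟨e, rfl⟩)
    have h0 : 0 ≤ η * N (ζ₀ → Option β) := mul_nonneg hη.le N_nonneg
    simp only [Finset.notMem_empty, false_imp_iff, implies_true, if_true]
    exact le_trans this h0
  | insert b B hb ih =>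
    intro ζ₀ _ η hη
    obtain ⟨ζ₁, _, h1⟩ := ih ζ₀ (η / 2) (by positivity)
    obtain ⟨ζ, _, h2⟩ := tile h b ζ₁ (η / 2) (by positivity)
    refine ⟨ζ, inferInstance, fun f hf hfV D hD => ?_⟩
    have h3 := h2 (fun x => (if ∀ b ∈ B, D b x then f x else 0) - η / 2) (fun x => by
        have := hf x
        split_ifs <;> linarith) (fun V hV => by
        rw [S_sub, S_const]
        have := h1 (fun u => f (ev V u)) (fun u => hf _) (fun W hW => by
          have := hfV (comp V W) (hV.comp hW)
          simpa only [ev_comp] using this) (fun b u => D b (ev V u)) (fun b => (hD b).pull V)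
        linarith) (D b) (hD b)
    have h4 : S (fun x => if ∀ b' ∈ insert b B, D b' x then f x else 0) ≤
        S (fun x => (if D b x then (if ∀ b ∈ B, D b x then f x else 0) - η / 2 else 0) + η / 2) := by
      apply S_le
      intro x
      simp only [Finset.forall_mem_insert]
      by_cases h5 : D b x
      · simp [h5]
      · simp [h5]; positivity
    rw [S_add, S_const] at h4
    linarith

lemma tile_compl {β : Type} [Finite β] [Nonempty β] (h : HasDHJ β) 
    (ζ₀ : Type) [Finite ζ₀] (η : ℝ) (hη : 0 < η) :
    ∃ (ζ : Type) (_ : Finite ζ), ∀ f : (ζ → Option β) → ℝ, (∀ x, f x ≤ 1) →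
      (∀ V : ζ → Option β ⊕ ζ₀, Proper V → S (fun u => f (ev V u)) ≤ 0) →
      ∀ D : β → (ζ → Option β) → Prop, (∀ b, Insens b (D b)) →
        S (fun x => if ∀ b, D b x then 0 else f x) ≤ η * N (ζ → Option β) := by
  let _ := Fintype.ofFinite β
  have hP : 0 < N (Set β) := N_pos
  obtain ⟨ζ, _, hζ⟩ := multi_tile h (Finset.univ : Finset β) ζ₀ (η / N (Set β)) (by positivity)
  refine ⟨ζ, inferInstance, fun f hf hfV D hD => ?_⟩
  have h1 : ∀ T : Set β, S (fun x => if ∀ b, (D b x ↔ b ∈ T) then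
      (if T = Set.univ then 0 else f x) else 0) ≤ η / N (Set β) * N (ζ → Option β) := by
    intro T
    by_cases hT : T = Set.univ
    · simp only [hT, if_true, ite_self]
      rw [S_const]
      have := N_nonneg (X := ζ → Option β)
      simp only [zero_mul]; positivity
    · have := hζ f hf hfV (fun b x => D b x ↔ b ∈ T) (fun b x => iff_congr (hD b x) Iff.rfl)
      simpa [hT] using this
  have h2 := S_le h1
  rw [S_const, S_comm] at h2
  have e : η / N (Set β) * N (ζ → Option β) * N (Set β) = η * N (ζ → Option β) := by
    field_simp
  rw [e] at h2
  refine le_trans (le_of_eq ?_) h2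
  congr 1; ext x
  let _ := Fintype.ofFinite (Set β)
  rw [S_eq, Finset.sum_eq_single {b | D b x}]
  · simp [Set.eq_univ_iff_forall]
  · intro T _ hT
    rw [if_neg]
    intro hc
    apply hT
    ext b
    exact (hc b).symm
  · simp

end DHJ

namespace DHJ
open Classical

/-- Evaluation of a subspace with fixed letters in `β` on letters in `Option β`. -/
def eo {ι β η ζ : Type*} (V : ι → β ⊕ (η ⊕ ζ)) (u : η → Option β) (s : ζ → Option β) :
    ι → Option β := fun i => Sum.elim some (Sum.elim u s) (V i)

lemma gr_lite (β η : Type) [Finite β] [Finite η] (J : Finset η) :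
    ∀ (ζ : Type) [Finite ζ], ∃ (ι : Type) (_ : Finite ι), ∀ C : (ι → Option β) → Prop,
      ∃ V : ι → β ⊕ (η ⊕ ζ), Proper V ∧ ∀ u : η → Option β, (∃ j ∈ J, u j = none) →
        ∀ s s', C (eo V u s) → C (eo V u s') := by
  induction J using Finset.induction_on with
  | empty =>
    intro ζ _
    exact ⟨η ⊕ ζ, inferInstance, fun C => ⟨Sum.inr, fun e => ⟨e, rfl⟩, by simp⟩⟩
  | insert j J hj ih =>
    intro ζ _
    obtain ⟨ρ, _, hρ⟩ := Combinatorics.Subspace.exists_mono_in_high_dimension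
      (Option β) ((η → Option β) → Prop) ζ
    obtain ⟨ι, _, hι⟩ := ih ρ
    refine ⟨ι, inferInstance, fun C => ?_⟩
    obtain ⟨V, hV, hVC⟩ := hι C
    obtain ⟨U, c, hU⟩ := hρ (fun s u => C (eo V u s))
    let T : ρ → β ⊕ (η ⊕ ζ) := fun r =>
      Sum.elim (fun o => o.elim (Sum.inr (Sum.inl j)) Sum.inl) (fun z => Sum.inr (Sum.inr z))
        (U.idxFun r)
    let V' : ι → β ⊕ (η ⊕ ζ) := fun i =>
      Sum.elim Sum.inl (Sum.elim (fun e => Sum.inr (Sum.inl e)) T) (V i)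
    have hev : ∀ u s, eo V' u s = eo V u (eo T u s) := by
      intro u s
      ext1 i
      simp only [eo, V']
      rcases V i with b | e | r <;> rfl
    refine ⟨V', ?_, ?_⟩
    · rintro (e | z)
      · obtain ⟨i, hi⟩ := hV (Sum.inl e)
        exact ⟨i, by simp [V', hi]⟩
      · obtain ⟨r, hr⟩ := U.proper z
        obtain ⟨i, hi⟩ := hV (Sum.inr r)
        exact ⟨i, by simp [V', hi, T, hr]⟩
    · rintro u ⟨j', hj', hu⟩ s s'
      rw [hev, hev]
      rcases Finset.mem_insert.1 hj' with rfl | hj'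
      · have hT : ∀ s, eo T u s = U s := by
          intro s
          ext1 r
          simp only [eo, T, Combinatorics.Subspace.apply_def]
          rcases U.idxFun r with (_ | b) | z <;> simp [hu]
        rw [hT, hT]
        have h1 := congrFun (hU s) u
        have h2 := congrFun (hU s') u
        dsimp only at h1 h2
        rw [h1, h2]
        exact id
      · exact hVC u ⟨j', hj', hu⟩ _ _

/-- Sets without combinatorial lines. -/
def LF {ι α : Type*} (A : (ι → α) → Prop) : Prop :=
  ∀ x : ι → Option α, IsVar x → ¬ ∀ a, A (sub x a)

lemma LF.pull {ι α ζ : Type*} {A : (ι → α) → Prop} (hA : LF A) {W : ι → α ⊕ ζ} (hW : Proper W) :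
    LF (fun u => A (ev W u)) := by
  rintro x ⟨z, hz⟩ hx
  obtain ⟨i, hi⟩ := hW z
  refine hA (fun i => Sum.elim some x (W i)) ⟨i, by simp [hi, hz]⟩ fun a => ?_
  convert hx a using 1
  ext1 i
  simp only [ev, sub]
  cases W i <;> rfl

lemma LF.slice_right {ι κ α : Type*} {A : (ι ⊕ κ → α) → Prop} (hA : LF A) (x : ι → α) :
    LF (fun y => A (Sum.elim x y)) := by
  have := hA.pull (W := Sum.elim (fun i => Sum.inl (x i)) Sum.inr) (fun e => ⟨Sum.inr e, rfl⟩)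
  convert this using 3 with y
  ext1 i
  cases i <;> rfl

lemma LF.slice_left {ι κ α : Type*} {A : (ι ⊕ κ → α) → Prop} (hA : LF A) (y : κ → α) :
    LF (fun x => A (Sum.elim x y)) := by
  have := hA.pull (W := Sum.elim Sum.inr (fun i => Sum.inl (y i))) (fun e => ⟨Sum.inl e, rfl⟩)
  convert this using 3 with y
  ext1 i
  cases i <;> rfl

lemma LF.not_all {ι β : Type*} {A : (ι → Option β) → Prop} (hA : LF A) (x : ι → Option β)
    (hx : IsVar x) (hb : ∀ b, A (fl b x)) : ¬ A x := by
  intro h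
  obtain ⟨i, hi⟩ := hx
  refine hA (fun i => (x i).map some) ⟨i, by simp [hi]⟩ ?_
  rintro (_ | b)
  · convert h using 1
    ext1 i
    simp only [sub]
    cases x i <;> rfl
  · convert hb b using 1
    ext1 i
    simp only [sub, fl]
    cases x i <;> rfl

lemma core {β : Type} [Finite β] [Nonempty β] (h : HasDHJ β) (δ : ℝ) (hδ : 0 < δ)
    (H1 : ∀ ε : ℝ, 0 < ε → ∃ (ι : Type) (_ : Finite ι), ∀ A : (ι → Option β) → Prop, LF A →
      cnt A ≤ (δ + ε) * N (ι → Option β))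
    (H2 : ∀ ε : ℝ, 0 < ε → ∀ (ι : Type) [Finite ι], ∃ A : (ι → Option β) → Prop, LF A ∧
      (δ - ε) * N (ι → Option β) ≤ cnt A) : False := by
  obtain ⟨η, _, hη⟩ := h (δ / 2 / 2) (by positivity)
  have hKη : 0 < N (η → Option β) := N_pos
  obtain ⟨θ, hθ⟩ : ∃ θ, θ = δ / 2 / (2 * N (η → Option β)) := ⟨_, rfl⟩
  have hθ0 : 0 < θ := by rw [hθ]; positivity
  have hγ : 0 < δ * θ / 4 := by positivity
  obtain ⟨ζ₀, _, hζ₀⟩ := H1 (δ * θ / 4) hγ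
  obtain ⟨ζ, _, hζ⟩ := tile_compl h ζ₀ (δ * θ / 4) hγ
  let _ := Fintype.ofFinite η
  obtain ⟨ι, _, hι⟩ := gr_lite β η Finset.univ ζ
  have hN1 : 0 < N (ι → Option β) := N_pos
  have hm : 0 < min (δ / 2) (δ * θ / 4) := by positivity
  obtain ⟨ε, hε⟩ : ∃ ε, ε = min (δ / 2) (δ * θ / 4) / (2 * N (ι → Option β)) := ⟨_, rfl⟩
  have hε0 : 0 < ε := by rw [hε]; positivity
  have hεm : 2 * ε * N (ι → Option β) = min (δ / 2) (δ * θ / 4) := by rw [hε]; field_simp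
  obtain ⟨κ, _, hκ⟩ := H1 ε hε0
  obtain ⟨A, hA, hAd⟩ := H2 ε hε0 (ι ⊕ κ)
  have hN2 : 0 < N (κ → Option β) := N_pos
  -- all slices are dense
  have hslice : ∀ x : ι → Option β, (δ - min (δ / 2) (δ * θ / 4)) * N (κ → Option β) ≤
      cnt (fun y => A (Sum.elim x y)) := by
    intro x
    rw [cnt_sum, N_sum] at hAd
    have h1 := le_S (f := fun x => (δ + ε) * N (κ → Option β) - cnt (fun y => A (Sum.elim x y)))
      (fun x => sub_nonneg.2 (hκ _ (hA.slice_right x))) x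
    rw [S_sub, S_const] at h1
    have h2 : 2 * ε * N (ι → Option β) * N (κ → Option β) =
      min (δ / 2) (δ * θ / 4) * N (κ → Option β) := by rw [hεm]
    have h3 : 0 < ε * N (κ → Option β) := by positivity
    linarith
  -- good words
  obtain ⟨V, hV, hVC⟩ := hι (fun x => θ * N (κ → Option β) ≤
    cnt (fun y => ∀ b, A (Sum.elim (fl b x) y)))
  let b₀ : β := Classical.arbitrary β
  let s₀ : ζ → Option β := fun _ => some b₀
  obtain ⟨u, hu⟩ := pigeon (X := η → β) (Ω := κ → Option β) (K := η → Option β) (δ / 2)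
    (by positivity) (fun w y => A (Sum.elim (eo V (fun e => some (w e)) s₀) y))
    (fun u y => IsVar u ∧ ∀ b, A (Sum.elim (eo V (fun e => some (sub u b e)) s₀) y))
    (by
      have : S (fun _ : η → β => δ / 2 * N (κ → Option β)) ≤ _ := S_le fun w : η → β =>
        le_trans (mul_le_mul_of_nonneg_right (show δ / 2 ≤ δ - min (δ / 2) (δ * θ / 4) by
          have := min_le_left (δ / 2) (δ * θ / 4)
          linarith) hN2.le) (hslice (eo V (fun e => some (w e)) s₀))
      rw [S_const] at this
      linarith)
    (fun y hy => hη _ hy)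
  rw [← hθ] at hu
  obtain ⟨-, huv, -⟩ := exists_of_cnt_pos (lt_of_lt_of_le (by positivity) hu)
  have hgood : ∀ s, θ * N (κ → Option β) ≤ cnt (fun y => ∀ b, A (Sum.elim (fl b (eo V u s)) y)) := by
    intro s
    obtain ⟨j, hj⟩ := huv
    refine hVC u ⟨j, Finset.mem_univ _, hj⟩ s₀ s (hu.trans (cnt_mono fun y hy b => ?_))
    convert hy.2 b using 2
    ext1 i
    simp only [fl, eo, sub]
    rcases V i with a | e | z <;> rfl
  let W : ι → Option β ⊕ ζ := fun i =>
    Sum.elim (fun b => Sum.inl (some b)) (Sum.elim (fun e => Sum.inl (u e)) Sum.inr) (V i)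
  have hWe : ∀ s, ev W s = eo V u s := by
    intro s
    ext1 i
    simp only [ev, eo, W]
    rcases V i with a | e | z <;> rfl
  have hW : Proper W := by
    intro z
    obtain ⟨i, hi⟩ := hV (Sum.inr z)
    exact ⟨i, by simp [W, hi]⟩
  have hvar : ∀ s, IsVar (ev W s) := by
    intro s
    obtain ⟨j, hj⟩ := huv
    obtain ⟨i, hi⟩ := hV (Sum.inl j)
    exact ⟨i, by simp [ev, W, hi, hj]⟩
  simp only [← hWe] at hgood
  -- density bound for each `y`
  have hy : ∀ y : κ → Option β, cnt (fun s => A (Sum.elim (ev W s) y)) ≤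
      (δ + δ * θ / 4) * (N (ζ → Option β) - cnt (fun s => ∀ b, A (Sum.elim (fl b (ev W s)) y)))
        + δ * θ / 4 * N (ζ → Option β) := by
    intro y
    have hLF : LF (fun s => A (Sum.elim (ev W s) y)) := (hA.slice_left y).pull hW
    have h1 := hζ (fun s => (if A (Sum.elim (ev W s) y) then 1 else 0) - (δ + δ * θ / 4))
      (fun s => by
        have : 0 < δ + δ * θ / 4 := by positivity
        split_ifs <;> linarith)
      (fun X hX => by
        rw [S_sub, S_const]
        have := hζ₀ _ (hLF.pull hX)
        unfold cnt at this
        linarith)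
      (fun b s => A (Sum.elim (fl b (ev W s)) y))
      (fun b s => by
        have : fl b (ev W (fl b s)) = fl b (ev W s) := by
          ext1 i
          simp only [fl, ev]
          cases W i <;> rfl
        show A (Sum.elim (fl b (ev W s)) y) ↔ A (Sum.elim (fl b (ev W (fl b s))) y)
        rw [this])
    have h2 : S (fun s : ζ → Option β => (if A (Sum.elim (ev W s) y) then (1 : ℝ) else 0) -
        (δ + δ * θ / 4) * (if ¬ ∀ b, A (Sum.elim (fl b (ev W s)) y) then 1 else 0)) ≤
        δ * θ / 4 * N (ζ → Option β) := by
      refine le_trans (le_of_eq ?_) h1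
      congr 1; ext s
      by_cases hb : ∀ b, A (Sum.elim (fl b (ev W s)) y)
      · have := (hA.slice_left y).not_all _ (hvar s) hb
        simp [hb, this]
      · simp [hb]
    rw [S_sub, S_mul] at h2
    rw [← cnt_not]
    unfold cnt
    have : ∀ a b c : ℝ, a - b ≤ c → a ≤ b + c := fun a b c h => by linarith
    refine (this _ _ _ h2).trans (le_of_eq ?_)
    congr!
  have hsum := S_le hy
  rw [S_add, S_mul, S_sub, S_const, S_const] at hsum
  have h5 : S (fun _ : ζ → Option β => (δ - δ * θ / 4) * N (κ → Option β)) ≤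
      S (fun s : ζ → Option β => cnt (fun y => A (Sum.elim (ev W s) y))) :=
    S_le fun s => le_trans (mul_le_mul_of_nonneg_right (by
      have := min_le_right (δ / 2) (δ * θ / 4)
      linarith) hN2.le) (hslice (ev W s))
  have h6 := S_le hgood
  rw [S_cnt_comm] at h5 h6
  rw [S_const] at h5 h6
  have hN0 : 0 < N (ζ → Option β) := N_pos
  have h7 := mul_le_mul_of_nonneg_left h6 (show 0 ≤ δ + δ * θ / 4 by positivity)
  have hP : 0 < N (κ → Option β) * N (ζ → Option β) := by positivity
  set P := N (κ → Option β) * N (ζ → Option β) with hPd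
  have e1 : (δ - δ * θ / 4) * N (κ → Option β) * N (ζ → Option β) = (δ - δ * θ / 4) * P := by ring
  have e2 : θ * N (κ → Option β) * N (ζ → Option β) = θ * P := by ring
  rw [e1] at h5
  rw [e2] at h7
  have e3 : N (ζ → Option β) * N (κ → Option β) = P := by ring
  have e4 : δ * θ / 4 * N (ζ → Option β) * N (κ → Option β) = δ * θ / 4 * P := by ring
  rw [mul_sub, e3, e4] at hsum
  have h8 : (δ - δ * θ / 4) * P ≤ (δ + δ * θ / 4) * P - (δ + δ * θ / 4) * (θ * P) + δ * θ / 4 * P := by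
    linarith
  have h9 : 0 < δ * θ * P := by positivity
  have h10 : 0 < δ * θ * θ * P := by positivity
  nlinarith

lemma step {β : Type} [Finite β] [Nonempty β] (h : HasDHJ β) : HasDHJ (Option β) := by
  by_contra hcon
  unfold HasDHJ at hcon
  push Not at hcon
  obtain ⟨δ₀, hδ₀, hcon⟩ := hcon
  let Q : Set ℝ := {δ | ∀ (ι : Type) [Finite ι], ∃ A : (ι → Option β) → Prop, LF A ∧
      δ * N (ι → Option β) ≤ cnt A}
  have hQ0 : δ₀ ∈ Q := by
    intro ι _
    obtain ⟨A, h1, h2⟩ := hcon ι inferInstance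
    refine ⟨A, fun x hx hc => ?_, h1⟩
    obtain ⟨b, hb⟩ := h2 x hx
    exact hb (hc b)
  have hQb : BddAbove Q := by
    refine ⟨1, fun δ hδ => ?_⟩
    obtain ⟨A, -, hA⟩ := hδ Unit
    have h1 := cnt_le_N A
    have h2 : 0 < N (Unit → Option β) := N_pos
    by_contra hc
    push Not at hc
    nlinarith
  have hpos : 0 < sSup Q := lt_of_lt_of_le hδ₀ (le_csSup hQb hQ0)
  refine core h (sSup Q) hpos ?_ ?_
  · intro ε hε
    have : sSup Q + ε ∉ Q := fun hc => by
      have := le_csSup hQb hc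
      linarith
    simp only [Q, Set.mem_ofPred_eq] at this
    push Not at this
    obtain ⟨ι, _, hι⟩ := this
    exact ⟨ι, inferInstance, fun A hA => (hι A hA).le⟩
  · intro ε hε ι _
    obtain ⟨δ, hδ, hlt⟩ := exists_lt_of_lt_csSup ⟨δ₀, hQ0⟩ (show sSup Q - ε < sSup Q by linarith)
    obtain ⟨A, hA, hAd⟩ := hδ ι
    refine ⟨A, hA, le_trans (mul_le_mul_of_nonneg_right hlt.le N_nonneg) hAd⟩

lemma N_congr {X Y : Type*} [Finite X] [Finite Y] (e : X ≃ Y) : N X = N Y := by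
  rw [N_eq, N_eq, Nat.card_congr e]

lemma HasDHJ.congr {β γ : Type} [Finite β] [Finite γ] (e : β ≃ γ) (h : HasDHJ β) : HasDHJ γ := by
  intro δ hδ
  obtain ⟨ι, _, hι⟩ := h δ hδ
  refine ⟨ι, inferInstance, fun A hA => ?_⟩
  let E : (ι → β) ≃ (ι → γ) := Equiv.arrowCongr (Equiv.refl ι) e
  obtain ⟨x, hx, hxA⟩ := hι (fun w => A (E w)) (by rw [cnt_equiv E, N_congr E]; exact hA)
  obtain ⟨i, hi⟩ := hx
  refine ⟨fun i => (x i).map e, ⟨i, by simp [hi]⟩, fun c => ?_⟩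
  convert hxA (e.symm c) using 1
  ext1 i
  simp only [sub, E, Equiv.arrowCongr_apply, Function.comp, Equiv.refl_symm, Equiv.refl_apply]
  cases x i <;> simp

lemma dhj_fin : ∀ k : ℕ, HasDHJ (Fin (k + 1))
  | 0 => by
    intro δ hδ
    refine ⟨Unit, inferInstance, fun A hA => ?_⟩
    obtain ⟨w, hw⟩ := exists_of_cnt_pos (lt_of_lt_of_le (mul_pos hδ N_pos) hA)
    refine ⟨fun _ => none, ⟨(), rfl⟩, fun b => ?_⟩
    convert hw
    ext1 i
    exact Subsingleton.elim (α := Fin 1) _ _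
  | k + 1 => (step (dhj_fin k)).congr finSuccEquivLast.symm

end DHJ

open DHJ in
/-- Density Hales–Jewett (Furstenberg–Katznelson): let `α` be a finite alphabet with `k`
letters, and identify words over `α` with lists. If `A` is a set of words with
`limsup_n |A ∩ W_n(α)| / k^n > 0`, then `A` contains a combinatorial line: there is a
variable word (a list over `Option α` with at least one occurrence of the variable `none`)
all of whose instantiations (substituting a fixed letter `a` for every occurrence of the
variable) belong to `A`. -/
theorem density_hales_jewett {α : Type*} [Fintype α] (k : ℕ) (hk : Fintype.card α = k)
    (A : Set (List α))
    (hA : 0 < Filter.limsup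
      (fun n => (Set.ncard {w | w ∈ A ∧ w.length = n} : ℝ) / (k : ℝ) ^ n) Filter.atTop) :
    ∃ w : List (Option α), Option.none ∈ w ∧
      ∀ a : α, w.map (fun o => o.getD a) ∈ A := by
  classical
  obtain ⟨δ, hδ0, hδ⟩ := exists_between hA
  have hfreq := Filter.frequently_lt_of_lt_limsup
    (Filter.IsCoboundedUnder.of_frequently_ge (a := 0)
      (Filter.Frequently.of_forall fun n => by positivity)) hδ
  rcases k with _ | k
  · have : IsEmpty α := Fintype.card_eq_zero_iff.1 hk
    exact ⟨[none], by simp, fun a => this.elim a⟩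
  let e : α ≃ Fin (k + 1) := Fintype.equivFinOfCardEq hk
  obtain ⟨n₀, hn₀⟩ := mdhj_emb (dhj_fin k) Unit δ hδ0
  obtain ⟨n, hn, hd⟩ := (Filter.frequently_atTop.1 hfreq) n₀
  let B : (Fin n → Fin (k + 1)) → Prop := fun w => List.ofFn (fun i => e.symm (w i)) ∈ A
  have hcard : (Set.ncard {w | w ∈ A ∧ w.length = n} : ℝ) = cnt B := by
    have h1 : {w | w ∈ A ∧ w.length = n} =
        (fun w : Fin n → Fin (k + 1) => List.ofFn (fun i => e.symm (w i))) '' {w | B w} := by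
      ext w
      constructor
      · rintro ⟨hw, rfl⟩
        refine ⟨fun i => e (w.get i), ?_, ?_⟩
        · simpa [B] using hw
        · simp
      · rintro ⟨v, hv, rfl⟩
        exact ⟨hv, by simp⟩
    rw [h1, Set.ncard_image_of_injective]
    · unfold cnt
      rw [S_eq, Finset.sum_boole, Set.ncard_eq_toFinset_card']
      simp
    · intro v v' hvv
      have := List.ofFn_injective hvv
      ext1 i
      exact e.symm.injective (congrFun this i)
  obtain ⟨V, hV, -, hVB⟩ := hn₀ (Fin n) (fun _ => True) (by simpa using hn) B (by
    rw [← hcard, N_pi, N_eq]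
    rw [lt_div_iff₀ (by positivity)] at hd
    simpa using hd.le)
  refine ⟨List.ofFn (fun i => Sum.elim (fun c => some (e.symm c)) (fun _ => none) (V i)), ?_, ?_⟩
  · obtain ⟨i, hi⟩ := hV ()
    rw [List.mem_ofFn]
    exact ⟨i, by simp [hi]⟩
  · intro a
    have := hVB (fun _ => e a)
    simp only [B] at this
    rw [List.map_ofFn]
    convert this using 2
    ext1 i
    simp only [ev, Function.comp]
    cases V i <;> simp
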